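/- arXiv:2502.14872 — 2 statements merged into one kernel-verified Lean document; each statement's English description precedes it below -/
import Mathlib

section
/- Let f be a polynomial with real coefficients, let α ≠ 0 be a real number with f(α) = 0 and f'(α) ≠ 0 (a simple root), and let q be a nonzero integer. Then the extended Newton's method 3 converges quadratically at α: there exist δ > 0 and C > 0 such that for all real x, y with |x − α| < δ, |y − α| < δ and y^q = x^q − q·x^{q−1}·f(x)/f'(x), one has |y − α| ≤ C·|x − α|². -/
open Filter Topology Asymptotics

/-- An analytic function whose derivative vanishes at `a` is constant up to second order at `a`. -/
theorem AnalyticAt.isBigO_sub_sq_of_hasDerivAt_zero {g : ℝ → ℝ} {a : ℝ} (hg : AnalyticAt ℝ g a)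
    (hg' : HasDerivAt g 0 a) : (fun x => g x - g a) =O[𝓝 a] fun x => |x - a| ^ 2 := by
  obtain ⟨p, hp⟩ := hg
  have hone : p 1 (fun _ => 1) = 0 := hp.deriv.symm.trans hg'.deriv
  have hsum : ∀ y, p.partialSum 2 y = g a := by
    intro y
    have hcoeff : p.coeff 1 = 0 := hone
    have hzero : p.coeff 0 = g a := hp.coeff_zero _
    simp [FormalMultilinearSeries.partialSum, Finset.sum_range_succ, hcoeff, hzero]
  have hO := hp.isBigO_sub_partialSum_pow 2
  simp only [hsum] at hO
  have ht : Tendsto (fun x : ℝ => x - a) (𝓝 a) (𝓝 0) := by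
    simpa using (continuous_id.sub continuous_const).tendsto (x := a) (f := fun x : ℝ => x - a)
  simpa [Function.comp_def] using hO.comp_tendsto ht

/-- Quadratic convergence of the extended Newton's method 3 (Tsuchikura–Horiguchi's
method) at a simple nonzero root of a real polynomial. -/
theorem tsuchikura_horiguchi_quadratic_convergence
    (f : Polynomial ℝ) (α : ℝ) (hα : α ≠ 0)
    (hroot : f.eval α = 0) (hsimple : f.derivative.eval α ≠ 0)
    (q : ℤ) (hq : q ≠ 0) :
    ∃ δ > 0, ∃ C > 0, ∀ x y : ℝ,
      |x - α| < δ → |y - α| < δ →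
      y ^ q = x ^ q - (q : ℝ) * x ^ (q - 1) * f.eval x / f.derivative.eval x →
      |y - α| ≤ C * |x - α| ^ 2 := by
  set G : ℝ → ℝ := fun x => x ^ q - (q : ℝ) * x ^ (q - 1) * f.eval x / f.derivative.eval x with hG
  have hGα : G α = α ^ q := by simp [hG, hroot]
  have hpow : ∀ n : ℤ, AnalyticAt ℝ (fun x : ℝ => x ^ n) α := fun n => analyticAt_id.zpow hα
  have heval : ∀ p : Polynomial ℝ, AnalyticAt ℝ (fun x => p.eval x) α := fun p => by
    simpa using (analyticAt_id (𝕜 := ℝ) (z := α)).aeval_polynomial p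
  have hGan : AnalyticAt ℝ G α :=
    (hpow q).sub (((analyticAt_const.mul (hpow (q - 1))).mul (heval f)).div
      (heval f.derivative) hsimple)
  have hpow' : HasDerivAt (fun x : ℝ => x ^ q) (q * α ^ (q - 1)) α :=
    hasDerivAt_zpow q α (Or.inl hα)
  have hG' : HasDerivAt G 0 α := by
    have h := hpow'.sub ((((hasDerivAt_zpow (q - 1) α (Or.inl hα)).const_mul (q : ℝ)).mul
      (f.hasDerivAt α)).div (f.derivative.hasDerivAt α) hsimple)
    refine h.congr_deriv ?_
    simp only [Pi.mul_apply, hroot]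
    field_simp
    ring
  obtain ⟨A, hA, hGA⟩ := (hGan.isBigO_sub_sq_of_hasDerivAt_zero hG').exists_pos
  have hne : (q : ℝ) * α ^ (q - 1) ≠ 0 := mul_ne_zero (by exact_mod_cast hq) (zpow_ne_zero _ hα)
  have hyO : (fun y => y - α) =O[𝓝 α] fun y => y ^ q - α ^ q := by
    have h := (HasDerivAtFilter.isTheta_sub hpow' hne).isBigO_symm
    rw [prod_pure, isBigO_map] at h
    exact h
  obtain ⟨B, hB, hyB⟩ := hyO.exists_pos
  obtain ⟨δ, hδ, h⟩ := Metric.eventually_nhds_iff.1 (hGA.bound.and hyB.bound)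
  refine ⟨δ, hδ, B * A, mul_pos hB hA, fun x y hx hy hxy => ?_⟩
  have hxG := (h (y := x) hx).1
  have hyG := (h (y := y) hy).2
  change y ^ q = G x at hxy
  rw [hxy, ← hGα] at hyG
  simp only [Real.norm_eq_abs, abs_pow, abs_abs] at hxG hyG
  calc |y - α| ≤ B * |G x - G α| := hyG
    _ ≤ B * (A * |x - α| ^ 2) := by gcongr
    _ = B * A * |x - α| ^ 2 := by ring
end

section
/- Let m, n ≥ 1 be natural numbers, c ∈ ℂ, and suppose the sequence a₀ = 0, a_{k+1} = a_k^{m·n} + c converges to α ∈ ℂ. Then: the sequence b₀ = 0, b_{k+1} = (b_k^m + c)^n converges to α^n; the sequence e₀ = 0, e_{k+1} = (e_k^n + c)^m converges to α^m; and the sequence d₀ = 0, d_{k+1} = (d_k + c)^{m·n} converges to α^{m·n}. -/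
open Filter Topology

/-- The orbit of `0` under `z ↦ (z^p + c)^q` is the `q`-th power of its orbit under
`z ↦ z^(p·q) + c`. -/
theorem deformed_orbit_eq_pow {R : Type*} [CommSemiring R] {p q : ℕ} (hq : q ≠ 0) {c : R}
    {a x : ℕ → R} (ha0 : a 0 = 0) (ha : ∀ k, a (k + 1) = a k ^ (p * q) + c)
    (hx0 : x 0 = 0) (hx : ∀ k, x (k + 1) = (x k ^ p + c) ^ q) (k : ℕ) :
    x k = a k ^ q := by
  induction k with
  | zero => rw [hx0, ha0, zero_pow hq]
  | succ k ih => rw [hx, ha, ih, ← pow_mul, mul_comm q p]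

/-- If the orbit of `0` under `z ↦ z^(m·n) + c` converges to `α`, then the orbits
under the three deformations converge to `α^n`, `α^m` and `α^(m·n)` respectively. -/
theorem deformations_converge
    (m n : ℕ) (hm : 1 ≤ m) (hn : 1 ≤ n) (c α : ℂ)
    (a b e d : ℕ → ℂ)
    (ha0 : a 0 = 0) (ha : ∀ k, a (k + 1) = a k ^ (m * n) + c)
    (hb0 : b 0 = 0) (hb : ∀ k, b (k + 1) = (b k ^ m + c) ^ n)
    (he0 : e 0 = 0) (he : ∀ k, e (k + 1) = (e k ^ n + c) ^ m)
    (hd0 : d 0 = 0) (hd : ∀ k, d (k + 1) = (d k + c) ^ (m * n))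
    (hconv : Tendsto a atTop (𝓝 α)) :
    Tendsto b atTop (𝓝 (α ^ n)) ∧
    Tendsto e atTop (𝓝 (α ^ m)) ∧
    Tendsto d atTop (𝓝 (α ^ (m * n))) := by
  have hm' : m ≠ 0 := Nat.one_le_iff_ne_zero.mp hm
  have hn' : n ≠ 0 := Nat.one_le_iff_ne_zero.mp hn
  refine ⟨(hconv.pow n).congr fun k => ?_, (hconv.pow m).congr fun k => ?_,
    (hconv.pow (m * n)).congr fun k => ?_⟩
  · exact (deformed_orbit_eq_pow hn' ha0 ha hb0 hb k).symm
  · exact (deformed_orbit_eq_pow hm' ha0 (by simpa only [mul_comm n m] using ha) he0 he k).symm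
  · exact (deformed_orbit_eq_pow (p := 1) (mul_ne_zero hm' hn') ha0
      (by simpa only [one_mul] using ha) hd0 (by simpa only [pow_one] using hd) k).symm
end
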